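/- Suppose r ∈ (-1,1], ν is a probability distribution on ℤ with ν(-2) > 0, and h_r^{(0)} is ν-harmonic on ℤ_{>0}. Let (H_i, T_i)_{i≥0} be the strict ascending ladder point process of (X_0 - X_i)_{i≥0}, defined by T_0 = 0, H_0 = 0, T_{i+1} = inf{ j > T_i : X_0 - X_j > H_i }, H_{i+1} = X_0 - X_{T_{i+1}} (with H_{i+1} = ∞ if T_{i+1} = ∞). Then for every integer l ≥ 0, ∑_{i=0}^∞ P(H_i = l) = h_r^{(0)}(l), and consequently the renewal function satisfies ∑_{i=0}^∞ P(H_i ≤ k) = h_r^{(1)}(k+1) for every k ≥ 0. -/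

import Mathlib

open scoped BigOperators

noncomputable def h0 (r : ℝ) (l : ℤ) : ℝ :=
  if 0 ≤ l then
    (4 : ℝ) ^ (-l) *
      ∑ m ∈ Finset.range (l.toNat + 1),
        (Nat.choose (2 * m) m : ℝ) * (Nat.choose (2 * (l.toNat - m)) (l.toNat - m) : ℝ) *
          (-r) ^ (l.toNat - m)
  else 0

noncomputable def h1 (r : ℝ) (l : ℤ) : ℝ :=
  if 1 ≤ l then ∑ p ∈ Finset.range l.toNat, h0 r (p : ℤ) else 0

noncomputable def h2 (r : ℝ) (l : ℤ) : ℝ :=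
  if 2 ≤ l then ∑ p ∈ Finset.Icc 1 (l.toNat - 1), h1 r (p : ℤ) else 0

noncomputable def hm1 (r : ℝ) (l : ℤ) : ℝ := h0 r (l + 1) - h0 r l

noncomputable def hm2 (r : ℝ) (l : ℤ) : ℝ := hm1 r (l + 1) - hm1 r l

noncomputable def kernelR (r : ℝ) (k m : ℤ) : ℝ :=
  ∑ p ∈ Finset.range m.toNat,
    h1 r (m - (p : ℤ)) * (hm2 r (k + (p : ℤ) - 1) + r * hm2 r (k + (p : ℤ) - 2))

/-- `ν` is a probability distribution on `ℤ`. -/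
def IsProbDist (ν : ℤ → ℝ) : Prop := (∀ k, 0 ≤ ν k) ∧ HasSum ν 1

/-- A nonnegative function `f : ℤ → [0,∞)` is `ν`-harmonic on `ℤ_{>0}`. -/
def NuHarmonic (ν : ℤ → ℝ) (f : ℤ → ℝ) : Prop :=
  (∀ l, 0 ≤ f l) ∧ ∀ k : ℤ, 1 ≤ k → HasSum (fun l : ℤ => f (k + l) * ν l) (f k)

noncomputable def Lnu (r : ℝ) (ν : ℤ → ℝ) : ℝ :=
  ∑' k : ℕ, ν ((k : ℤ) + 1) * h2 r ((k : ℤ) + 2)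

noncomputable def phiNu (ν : ℤ → ℝ) (θ : ℝ) : ℂ :=
  ∑' k : ℤ, (ν k : ℂ) * Complex.exp (Complex.I * (k : ℂ) * (θ : ℂ))

open MeasureTheory ProbabilityTheory

/-- The strict ascending ladder epochs of a sequence `S : ℕ → ℤ` (with `S 0` playing the
role of the starting value `0`): `T 0 = 0` and
`T (i+1) = inf { j > T i : S j > S (T i) }`, with value `∞` if no such `j` exists
(or if `T i = ∞`). -/
noncomputable def ladderTime (S : ℕ → ℤ) : ℕ → ℕ∞
  | 0 => 0
  | i + 1 =>
    sInf {j : ℕ∞ | ∃ tn jn : ℕ, ladderTime S i = (tn : ℕ∞) ∧ j = (jn : ℕ∞) ∧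
      tn < jn ∧ S tn < S jn}

/-- The normalized central binomial coefficient `C(2n, n) / 4 ^ n`. -/
noncomputable def arcsineCoeff (n : ℕ) : ℝ := (Nat.centralBinom n : ℝ) / 4 ^ n

lemma arcsineCoeff_zero : arcsineCoeff 0 = 1 := by simp [arcsineCoeff]

lemma arcsineCoeff_nonneg (n : ℕ) : 0 ≤ arcsineCoeff n := by
  unfold arcsineCoeff; positivity

lemma two_mul_succ_mul_arcsineCoeff_succ (n : ℕ) :
    2 * ((n : ℝ) + 1) * arcsineCoeff (n + 1) = (2 * n + 1) * arcsineCoeff n := by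
  have h : ((n : ℝ) + 1) * (Nat.centralBinom (n + 1) : ℝ) =
      2 * (2 * n + 1) * Nat.centralBinom n := by
    exact_mod_cast Nat.succ_mul_centralBinom_succ n
  unfold arcsineCoeff
  rw [pow_succ]
  field_simp
  linarith

lemma arcsineCoeff_sq_le (n : ℕ) : arcsineCoeff n ^ 2 * (n + 1) ≤ 1 := by
  induction n with
  | zero => simp [arcsineCoeff_zero]
  | succ n ih =>
    have h := two_mul_succ_mul_arcsineCoeff_succ n
    have hn : (0 : ℝ) < 4 * ((n : ℝ) + 1) ^ 3 := by positivity
    have h2 : 4 * ((n : ℝ) + 1) ^ 3 * (arcsineCoeff (n + 1) ^ 2 * ((n + 1 : ℕ) + 1)) =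
        (2 * n + 1) ^ 2 * (n + 2) * (arcsineCoeff n ^ 2 * (n + 1)) := by
      push_cast
      linear_combination ((n : ℝ) + 1) * (n + 2) *
        (2 * ((n : ℝ) + 1) * arcsineCoeff (n + 1) + (2 * n + 1) * arcsineCoeff n) * h
    have h3 : ((2 * n + 1) ^ 2 * (n + 2) : ℝ) ≤ 4 * ((n : ℝ) + 1) ^ 3 := by
      have : (0 : ℝ) ≤ n := n.cast_nonneg
      nlinarith
    refine le_of_mul_le_mul_left ?_ hn
    rw [h2, mul_one]
    exact (mul_le_of_le_one_right (by positivity) ih).trans h3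

lemma tendsto_zero_of_sq_mul_le {f : ℕ → ℝ} (h : ∀ n, f n ^ 2 * (n + 1) ≤ 1) :
    Filter.Tendsto f Filter.atTop (nhds 0) := by
  have h1 : Filter.Tendsto (fun n => f n ^ 2) Filter.atTop (nhds 0) := by
    refine squeeze_zero (fun n => sq_nonneg _) (fun n => ?_)
      (tendsto_one_div_add_atTop_nhds_zero_nat (𝕜 := ℝ))
    rw [le_div_iff₀ (by positivity)]
    exact h n
  have h2 := h1.sqrt
  simp only [Real.sqrt_sq_eq_abs, Real.sqrt_zero] at h2
  exact (tendsto_zero_iff_abs_tendsto_zero f).mpr h2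

lemma h0_natCast (r : ℝ) (l : ℕ) :
    h0 r l = ∑ j ∈ Finset.range (l + 1),
      arcsineCoeff j * (-r) ^ j * arcsineCoeff (l - j) := by
  rw [← Finset.sum_range_reflect]
  simp only [h0, Int.toNat_natCast, Nat.cast_nonneg, if_true, Finset.mul_sum]
  refine Finset.sum_congr rfl fun m hm => ?_
  have hm' : m ≤ l := Nat.lt_succ_iff.mp (Finset.mem_range.mp hm)
  have e : l + 1 - 1 - m = l - m := by omega
  have e2 : l - (l - m) = m := by omega
  rw [e, e2, arcsineCoeff, arcsineCoeff, Nat.centralBinom_eq_two_mul_choose,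
    Nat.centralBinom_eq_two_mul_choose, zpow_neg, zpow_natCast]
  have h4 : (4 : ℝ) ^ l = 4 ^ (l - m) * 4 ^ m := by rw [← pow_add]; congr 1; omega
  rw [h4]
  field_simp

lemma h0_of_neg (r : ℝ) {l : ℤ} (hl : l < 0) : h0 r l = 0 := by
  simp [h0, not_le.mpr hl]

lemma h0_zero (r : ℝ) : h0 r 0 = 1 := by simp [h0]

lemma tendsto_h0_of_abs_lt_one {r : ℝ} (hr : |r| < 1) :
    Filter.Tendsto (fun l : ℕ => h0 r l) Filter.atTop (nhds 0) := by
  have ha := tendsto_zero_of_sq_mul_le arcsineCoeff_sq_le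
  have ha1 : ∀ n, arcsineCoeff n ≤ 1 := fun n => by
    have h := arcsineCoeff_sq_le n
    have h0 : (0 : ℝ) ≤ n := n.cast_nonneg
    nlinarith [arcsineCoeff_nonneg n, sq_nonneg (arcsineCoeff n)]
  have key := tendsto_tsum_of_dominated_convergence (𝓕 := Filter.atTop)
    (f := fun (l j : ℕ) => if j ∈ Finset.range (l + 1) then
      arcsineCoeff j * (-r) ^ j * arcsineCoeff (l - j) else 0)
    (g := fun _ => (0 : ℝ)) (bound := fun j => |r| ^ j)
    (summable_geometric_of_lt_one (abs_nonneg r) hr) ?_ ?_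
  · simp only [tsum_zero] at key
    refine key.congr fun l => ?_
    rw [h0_natCast, tsum_eq_sum (s := Finset.range (l + 1))]
    · exact Finset.sum_congr rfl fun j hj => if_pos hj
    · exact fun j hj => if_neg hj
  · intro j
    have h := (ha.comp (Filter.tendsto_sub_atTop_nat j)).const_mul (arcsineCoeff j * (-r) ^ j)
    rw [mul_zero] at h
    refine h.congr' ?_
    filter_upwards [Filter.eventually_ge_atTop j] with l hl
    rw [if_pos (Finset.mem_range.mpr (by omega))]
    rfl
  · refine Filter.Eventually.of_forall fun l j => ?_
    split_ifs
    · rw [Real.norm_eq_abs, abs_mul, abs_mul, abs_pow, abs_neg,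
        abs_of_nonneg (arcsineCoeff_nonneg _), abs_of_nonneg (arcsineCoeff_nonneg _)]
      have hp : 0 ≤ |r| ^ j := by positivity
      calc arcsineCoeff j * |r| ^ j * arcsineCoeff (l - j)
          ≤ 1 * |r| ^ j * 1 := by
            gcongr
            · exact arcsineCoeff_nonneg _
            · exact ha1 _
            · exact ha1 _
        _ = |r| ^ j := by ring
    · simp

open PowerSeries in
lemma h0_one_add_two (l : ℕ) :
    ((l : ℝ) + 2) * h0 1 ((l + 2 : ℕ) : ℤ) = ((l : ℝ) + 1) * h0 1 (l : ℤ) := by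
  let A : PowerSeries ℝ := PowerSeries.mk arcsineCoeff
  let B : PowerSeries ℝ := PowerSeries.mk fun n => arcsineCoeff n * (-1) ^ n
  have hA : 2 * (1 - X) * derivative ℝ A = A := by
    have e : 2 * (1 - X) * derivative ℝ A =
        C 2 * (derivative ℝ A - X * derivative ℝ A) := by
      rw [map_ofNat]; ring
    rw [e]
    ext n
    rw [coeff_C_mul, map_sub]
    rcases n with _ | n
    · have h := two_mul_succ_mul_arcsineCoeff_succ 0
      simp [coeff_derivative, A] at h ⊢
      linarith
    · have h := two_mul_succ_mul_arcsineCoeff_succ (n + 1)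
      simp only [coeff_succ_X_mul, coeff_derivative, A, coeff_mk]
      push_cast at h ⊢
      linarith
  have hB : 2 * (1 + X) * derivative ℝ B = -B := by
    have e : 2 * (1 + X) * derivative ℝ B =
        C 2 * (derivative ℝ B + X * derivative ℝ B) := by
      rw [map_ofNat]; ring
    rw [e]
    ext n
    rw [coeff_C_mul, map_add, map_neg]
    rcases n with _ | n
    · have h := two_mul_succ_mul_arcsineCoeff_succ 0
      simp [coeff_derivative, B] at h ⊢
      linarith
    · have h := two_mul_succ_mul_arcsineCoeff_succ (n + 1)
      simp only [coeff_succ_X_mul, coeff_derivative, B, coeff_mk, pow_succ]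
      push_cast at h ⊢
      linear_combination ((-1) ^ n) * h
  have hAB : 2 * ((1 - X ^ 2) * derivative ℝ (A * B)) = 2 * (X * (A * B)) := by
    rw [Derivation.leibniz, smul_eq_mul, smul_eq_mul]
    linear_combination (1 + X) * B * hA + (1 - X) * A * hB
  have hAB2 : derivative ℝ (A * B) = X * (X * derivative ℝ (A * B)) + X * (A * B) := by
    have : CharZero (PowerSeries ℝ) := algebraRat.charZero _
    have h2 : (2 : PowerSeries ℝ) ≠ 0 := two_ne_zero
    linear_combination mul_left_cancel₀ h2 hAB
  have hc : ∀ n : ℕ, coeff n (A * B) = h0 1 (n : ℤ) := fun n => by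
    rw [mul_comm A B, coeff_mul, h0_natCast, Finset.Nat.sum_antidiagonal_eq_sum_range_succ_mk]
    simp [A, B]
  have h := congrArg (coeff (l + 1)) hAB2
  rw [map_add, coeff_succ_X_mul, coeff_succ_X_mul, hc, coeff_derivative, hc] at h
  rcases l with _ | l
  · simp at h ⊢
    linarith
  · rw [coeff_succ_X_mul, coeff_derivative, hc] at h
    push_cast at h ⊢
    rw [show (l : ℤ) + 1 + 2 = l + 1 + 1 + 1 by ring]
    linarith

lemma h0_one_sq_le (l : ℕ) : h0 1 (l : ℤ) ^ 2 * (l + 1) ≤ 1 := by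
  induction l using Nat.twoStepInduction with
  | zero => simp [h0]
  | one => simp [h0, Finset.sum_range_succ]
  | more n ih _ =>
    have h := h0_one_add_two n
    have hn : (0 : ℝ) < ((n : ℝ) + 2) ^ 2 := by positivity
    refine le_of_mul_le_mul_left ?_ hn
    have h2 : ((n : ℝ) + 2) ^ 2 * (h0 1 ((n + 2 : ℕ) : ℤ) ^ 2 * ((n + 2 : ℕ) + 1)) =
        (n + 1) * (n + 3) * (h0 1 (n : ℤ) ^ 2 * (n + 1)) := by
      push_cast at h ⊢
      linear_combination ((n : ℝ) + 3) *
        (((n : ℝ) + 2) * h0 1 ((n : ℤ) + 2) + (n + 1) * h0 1 (n : ℤ)) * h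
    rw [h2, mul_one]
    refine (mul_le_of_le_one_right (by positivity) ih).trans ?_
    nlinarith

lemma tendsto_h0 {r : ℝ} (hr : r ∈ Set.Ioc (-1 : ℝ) 1) :
    Filter.Tendsto (fun l : ℕ => h0 r l) Filter.atTop (nhds 0) := by
  rcases hr.2.eq_or_lt with rfl | h
  · exact tendsto_zero_of_sq_mul_le h0_one_sq_le
  · exact tendsto_h0_of_abs_lt_one (abs_lt.mpr ⟨hr.1, h⟩)

/-- Maximum principle: a function dominated by a null sequence which is harmonic on the positive
half-line and nonpositive off it is nonpositive. -/
lemma nonpos_of_harmonic {ν w : ℤ → ℝ} (hprob : IsProbDist ν) (hν2 : 0 < ν (-2))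
    (hw0 : ∀ l ≤ 0, w l ≤ 0)
    (hlim : Filter.Tendsto (fun l : ℕ => w l) Filter.atTop (nhds 0))
    (hharm : ∀ k : ℤ, 1 ≤ k → HasSum (fun l : ℤ => w (k + l) * ν l) (w k)) (l : ℤ) :
    w l ≤ 0 := by
  by_contra! hl
  obtain ⟨N, hN⟩ := Filter.eventually_atTop.mp (hlim.eventually (gt_mem_nhds hl))
  have hlN : ∀ j, w l ≤ w j → j ∈ Finset.Icc (1 : ℤ) N := fun j hj => by
    have h1 : 0 < j := by
      by_contra! h
      linarith [hw0 j h]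
    lift j to ℕ using h1.le
    have h2 : j < N := by
      by_contra! h
      linarith [hN j h]
    rw [Finset.mem_Icc]
    omega
  obtain ⟨k, -, hk⟩ := (Finset.Icc (1 : ℤ) N).exists_max_image w ⟨l, hlN l le_rfl⟩
  have hmax : ∀ j, w j ≤ w k := fun j => by
    by_cases hj : w l ≤ w j
    · exact hk j (hlN j hj)
    · exact (not_le.mp hj).le.trans (hk l (hlN l le_rfl))
  have hwk : 0 < w k := hl.trans_le (hmax l)
  have hstep : ∀ n : ℕ, w (k - 2 * n) = w k := fun n => by
    induction n with
    | zero => simp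
    | succ n ih =>
      have h1 : 1 ≤ k - 2 * n := by
        by_contra! h
        linarith [hw0 (k - 2 * n) (by omega)]
      have hs := (hprob.2.mul_left (w k)).sub (hharm _ h1)
      rw [mul_one, ih, sub_self] at hs
      have hz := (hasSum_zero_iff_of_nonneg fun j => by
        have := mul_le_mul_of_nonneg_right (hmax (k - 2 * n + j)) (hprob.1 j)
        simpa using this).mp hs
      have hz2 := congrFun hz (-2)
      simp only [Pi.zero_apply, ← sub_mul, mul_eq_zero, hν2.ne', or_false] at hz2
      rw [show k - 2 * ((n + 1 : ℕ) : ℤ) = k - 2 * n + -2 by push_cast; ring]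
      linarith
  have h := hw0 (k - 2 * k.toNat) (by omega)
  rw [hstep] at h
  linarith

lemma ladderTime_succ_eq_iff (S : ℕ → ℤ) (i n : ℕ) :
    ladderTime S (i + 1) = n ↔ ∃ t : ℕ, ladderTime S i = t ∧ t < n ∧ S t < S n ∧
      ∀ j, t < j → j < n → S j ≤ S t := by
  rw [ladderTime]
  set s : Set ℕ∞ := {j : ℕ∞ | ∃ tn jn : ℕ, ladderTime S i = (tn : ℕ∞) ∧ j = (jn : ℕ∞) ∧
      tn < jn ∧ S tn < S jn} with hs
  constructor
  · intro h
    have hne : s.Nonempty := by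
      by_contra hne
      rw [Set.not_nonempty_iff_eq_empty.mp hne, sInf_empty] at h
      exact ENat.top_ne_natCast n h
    obtain ⟨t, m, ht, hm, htm, hS⟩ := h ▸ csInf_mem hne
    obtain rfl : n = m := by exact_mod_cast hm
    refine ⟨t, ht, htm, hS, fun j htj hjn => ?_⟩
    by_contra! hj
    have hle : sInf s ≤ (j : ℕ∞) := sInf_le ⟨t, j, ht, rfl, htj, hj⟩
    rw [h] at hle
    exact absurd (by exact_mod_cast hle : n ≤ j) (not_le.mpr hjn)
  · rintro ⟨t, ht, htn, hS, hmin⟩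
    refine IsLeast.csInf_eq ⟨⟨t, n, ht, rfl, htn, hS⟩, ?_⟩
    rintro _ ⟨t', j, ht', rfl, htj, hSj⟩
    obtain rfl : t = t' := by exact_mod_cast ht.symm.trans ht'
    by_contra! hj
    exact absurd (hmin j htj (by exact_mod_cast hj)) (not_le.mpr hSj)

lemma lt_of_lt_ladderTime (S : ℕ → ℤ) {i n : ℕ} (h : ladderTime S i = n) :
    ∀ j < n, S j < S n := by
  induction i generalizing n with
  | zero =>
    obtain rfl : 0 = n := by
      rw [ladderTime] at h
      exact_mod_cast h
    simp
  | succ i ih =>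
    obtain ⟨t, ht, -, hS, hmin⟩ := (ladderTime_succ_eq_iff S i n).mp h
    intro j hj
    rcases lt_trichotomy j t with hjt | rfl | hjt
    · exact (ih ht j hjt).trans hS
    · exact hS
    · exact (hmin j hjt hj).trans_lt hS

lemma exists_ladderTime_le (S : ℕ → ℤ) (n : ℕ) :
    ∃ i t : ℕ, ladderTime S i = t ∧ t ≤ n ∧ ∀ j ≤ n, S j ≤ S t := by
  induction n with
  | zero =>
    refine ⟨0, 0, by rw [ladderTime]; rfl, le_rfl, fun j hj => ?_⟩
    rw [Nat.le_zero.mp hj]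
  | succ n ih =>
    obtain ⟨i, t, ht, htn, hmax⟩ := ih
    by_cases h : S (n + 1) ≤ S t
    · refine ⟨i, t, ht, by omega, fun j hj => ?_⟩
      rcases Nat.le_succ_iff.mp hj with hj | rfl
      exacts [hmax j hj, h]
    · rw [not_le] at h
      refine ⟨i + 1, n + 1, (ladderTime_succ_eq_iff S i (n + 1)).mpr
        ⟨t, ht, by omega, h, fun j _ hj => hmax j (by omega)⟩, le_rfl, fun j hj => ?_⟩
      rcases Nat.le_succ_iff.mp hj with hj | rfl
      exacts [(hmax j hj).trans h.le, le_rfl]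

lemma exists_ladderTime_eq_iff (S : ℕ → ℤ) (n : ℕ) :
    (∃ i, ladderTime S i = n) ↔ ∀ j < n, S j < S n := by
  refine ⟨fun ⟨i, hi⟩ => lt_of_lt_ladderTime S hi, fun h => ?_⟩
  obtain ⟨i, t, ht, htn, hmax⟩ := exists_ladderTime_le S n
  rcases htn.eq_or_lt with rfl | htn
  · exact ⟨i, ht⟩
  · exact absurd (hmax n le_rfl) (not_le.mpr (h t htn))

lemma exists_ladderTime_of_lt (S : ℕ → ℤ) {i k n : ℕ} (hik : i < k)
    (h : ladderTime S k = n) : ∃ t : ℕ, ladderTime S i = t ∧ S t < S n := by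
  induction k generalizing n with
  | zero => exact absurd hik (Nat.not_lt_zero i)
  | succ k ih =>
    obtain ⟨t, ht, -, hS, -⟩ := (ladderTime_succ_eq_iff S k n).mp h
    rcases Nat.lt_succ_iff_lt_or_eq.mp hik with hik | rfl
    · obtain ⟨t', ht', hS'⟩ := ih hik ht
      exact ⟨t', ht', hS'.trans hS⟩
    · exact ⟨t, ht, hS⟩

lemma ladderTime_index_unique (S : ℕ → ℤ) {i k t n : ℕ} (hi : ladderTime S i = t)
    (hk : ladderTime S k = n) (h : S t = S n) : i = k := by
  by_contra hne
  rcases lt_or_gt_of_ne hne with hik | hik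
  · obtain ⟨t', ht', hS⟩ := exists_ladderTime_of_lt S hik hk
    obtain rfl : t = t' := by exact_mod_cast hi.symm.trans ht'
    exact hS.ne h
  · obtain ⟨t', ht', hS⟩ := exists_ladderTime_of_lt S hik hi
    obtain rfl : n = t' := by exact_mod_cast hk.symm.trans ht'
    exact hS.ne h.symm

/-- `HitsZero n l y` says that the walk started at `l` with increments `y 0, y 1, …` enters
`(-∞, 0]` within `n` steps, and does so at `0`. -/
def HitsZero : ℕ → ℤ → (ℕ → ℤ) → Prop
  | 0, l, _ => l = 0
  | n + 1, l, y => l = 0 ∨ 0 < l ∧ HitsZero n (l + y 0) fun m => y (m + 1)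

lemma hitsZero_iff (n : ℕ) (l : ℤ) (y : ℕ → ℤ) :
    HitsZero n l y ↔ ∃ t ≤ n, l + ∑ m ∈ Finset.range t, y m = 0 ∧
      ∀ j < t, 0 < l + ∑ m ∈ Finset.range j, y m := by
  induction n generalizing l y with
  | zero => simp [HitsZero]
  | succ n ih =>
    rw [HitsZero, ih]
    constructor
    · rintro (rfl | ⟨hl, t, htn, ht, hj⟩)
      · exact ⟨0, by omega, by simp, by simp⟩
      · refine ⟨t + 1, by omega, ?_, fun j hjt => ?_⟩
        · rw [Finset.sum_range_succ']
          linarith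
        · rcases j with _ | j
          · simpa using hl
          · rw [Finset.sum_range_succ']
            linarith [hj j (by omega)]
    · rintro ⟨t, htn, ht, hj⟩
      rcases t with _ | t
      · left; simpa using ht
      · refine Or.inr ⟨by simpa using hj 0 (by omega), t, by omega, ?_, fun j hjt => ?_⟩
        · rw [Finset.sum_range_succ'] at ht
          linarith
        · have h := hj (j + 1) (by omega)
          rw [Finset.sum_range_succ'] at h
          linarith

/-- The probability that the `ν`-walk started at `l` enters `(-∞, 0]` within `n` steps, and does
so at `0`. -/
noncomputable def hitProb (ν : ℤ → ℝ) : ℕ → ℤ → ENNReal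
  | 0, l => if l = 0 then 1 else 0
  | n + 1, l => if l = 0 then 1 else if 0 < l then
      ∑' y, ENNReal.ofReal (ν y) * hitProb ν n (l + y) else 0

lemma hitProb_of_pos (ν : ℤ → ℝ) (n : ℕ) {l : ℤ} (hl : 0 < l) :
    hitProb ν (n + 1) l = ∑' y, ENNReal.ofReal (ν y) * hitProb ν n (l + y) := by
  rw [hitProb, if_neg hl.ne', if_pos hl]

lemma hitProb_zero (ν : ℤ → ℝ) (n : ℕ) : hitProb ν n 0 = 1 := by
  cases n <;> simp [hitProb]

lemma hitProb_of_neg (ν : ℤ → ℝ) (n : ℕ) {l : ℤ} (hl : l < 0) : hitProb ν n l = 0 := by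
  cases n <;> simp [hitProb, hl.ne, hl.le]

lemma hitProb_mono (ν : ℤ → ℝ) (l : ℤ) : Monotone fun n => hitProb ν n l := by
  refine monotone_nat_of_le_succ fun n => ?_
  induction n generalizing l with
  | zero =>
    by_cases hl : l = 0
    · simp [hl, hitProb_zero]
    · simp [hitProb, hl]
  | succ n ih =>
    rcases lt_trichotomy l 0 with hl | rfl | hl
    · rw [hitProb_of_neg ν _ hl, hitProb_of_neg ν _ hl]
    · rw [hitProb_zero, hitProb_zero]
    · rw [hitProb_of_pos ν _ hl, hitProb_of_pos ν _ hl]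
      exact ENNReal.tsum_le_tsum fun y => mul_le_mul_right (ih (l + y)) _

lemma hitProb_le_h0 {r : ℝ} {ν : ℤ → ℝ} (hprob : IsProbDist ν) (hharm : NuHarmonic ν (h0 r))
    (n : ℕ) (l : ℤ) : hitProb ν n l ≤ ENNReal.ofReal (h0 r l) := by
  rcases lt_trichotomy l 0 with hl | rfl | hl
  · rw [hitProb_of_neg ν _ hl]
    exact zero_le
  · simp [hitProb_zero, h0_zero]
  induction n generalizing l with
  | zero => simp [hitProb, hl.ne']
  | succ n ih =>
    rw [hitProb_of_pos ν _ hl, ← (hharm.2 l hl).tsum_eq,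
      ENNReal.ofReal_tsum_of_nonneg (fun y => mul_nonneg (hharm.1 _) (hprob.1 y))
        (hharm.2 l hl).summable]
    refine ENNReal.tsum_le_tsum fun y => ?_
    rw [ENNReal.ofReal_mul (hharm.1 _), mul_comm]
    refine mul_le_mul_left ?_ _
    rcases lt_trichotomy (l + y) 0 with hy | hy | hy
    · rw [hitProb_of_neg ν _ hy]
      exact zero_le
    · simp [hy, hitProb_zero, h0_zero]
    · exact ih _ hy

lemma iSup_hitProb_of_pos (ν : ℤ → ℝ) {l : ℤ} (hl : 0 < l) :
    ⨆ n, hitProb ν n l = ∑' y, ENNReal.ofReal (ν y) * ⨆ n, hitProb ν n (l + y) := by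
  have h : ∀ y, ENNReal.ofReal (ν y) * ⨆ n, hitProb ν n (l + y) =
      ⨆ n, ENNReal.ofReal (ν y) * hitProb ν n (l + y) := fun y => ENNReal.mul_iSup _ _
  rw [← (hitProb_mono ν l).iSup_nat_add 1, tsum_congr h]
  simp only [hitProb_of_pos ν _ hl]
  simp only [← lintegral_count]
  exact (lintegral_iSup (f := fun n y => ENNReal.ofReal (ν y) * hitProb ν n (l + y))
    (fun n => measurable_of_countable _) fun m n hmn y =>
      mul_le_mul_right (hitProb_mono ν (l + y) hmn) _).symm

lemma iSup_hitProb_eq_h0 {r : ℝ} (hr : r ∈ Set.Ioc (-1 : ℝ) 1) {ν : ℤ → ℝ}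
    (hprob : IsProbDist ν) (hν2 : 0 < ν (-2)) (hharm : NuHarmonic ν (h0 r)) (l : ℤ) :
    ⨆ n, hitProb ν n l = ENNReal.ofReal (h0 r l) := by
  set u : ℤ → ENNReal := fun l => ⨆ n, hitProb ν n l with hu
  have hle : ∀ l, u l ≤ ENNReal.ofReal (h0 r l) := fun l =>
    iSup_le fun n => hitProb_le_h0 hprob hharm n l
  have htop : ∀ l, u l ≠ ⊤ := fun l => ne_top_of_le_ne_top ENNReal.ofReal_ne_top (hle l)
  have hle' : ∀ l, (u l).toReal ≤ h0 r l := fun l =>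
    ENNReal.toReal_le_of_le_ofReal (hharm.1 l) (hle l)
  refine (hle l).antisymm ?_
  rw [ENNReal.ofReal_le_iff_le_toReal (htop l), ← sub_nonpos]
  refine nonpos_of_harmonic (w := fun l => h0 r l - (u l).toReal) hprob hν2 ?_ ?_ ?_ l
  · intro l hl
    rcases hl.lt_or_eq with hl | rfl
    · simp [h0_of_neg r hl]
    · simp [h0_zero, hu, hitProb_zero]
  · exact squeeze_zero (fun l => sub_nonneg.mpr (hle' l))
      (fun l => sub_le_self _ ENNReal.toReal_nonneg) (tendsto_h0 hr)
  · intro k hk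
    simp only [sub_mul]
    refine (hharm.2 k hk).sub ?_
    have h : u k = ∑' y, ENNReal.ofReal (ν y) * u (k + y) := iSup_hitProb_of_pos ν hk
    have h2 := ENNReal.hasSum_toReal (h ▸ htop k)
    rw [← ENNReal.tsum_toReal_eq fun y => ENNReal.mul_ne_top ENNReal.ofReal_ne_top (htop _),
      ← h] at h2
    simpa only [ENNReal.toReal_mul, ENNReal.toReal_ofReal (hprob.1 _), mul_comm] using h2

lemma hitsZero_succ_eq_iUnion {Ω : Type*} (Y : ℕ → Ω → ℤ) (n s : ℕ) {l : ℤ} (hl : 0 < l) :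
    {ω | HitsZero (n + 1) l fun m => Y (s + m) ω} =
      ⋃ y, Y s ⁻¹' {y} ∩ {ω | HitsZero n (l + y) fun m => Y (s + 1 + m) ω} := by
  ext ω
  simp [HitsZero, hl, hl.ne', add_assoc, add_comm 1]

lemma measurableSet_hitsZero {Ω : Type*} (Y : ℕ → Ω → ℤ) (n : ℕ) (l : ℤ) (s : ℕ) :
    MeasurableSet[⨆ i ∈ Set.Ici s, MeasurableSpace.comap (Y i) inferInstance]
      {ω | HitsZero n l fun m => Y (s + m) ω} := by
  induction n generalizing l s with
  | zero => exact @MeasurableSet.const _ (_) (l = 0)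
  | succ n ih =>
    by_cases hl : 0 < l
    · rw [hitsZero_succ_eq_iUnion Y n s hl]
      refine MeasurableSet.iUnion fun y => MeasurableSet.inter ?_ ?_
      · exact le_iSup₂_of_le (f := fun i (_ : i ∈ Set.Ici s) =>
          MeasurableSpace.comap (Y i) inferInstance) s Set.self_mem_Ici le_rfl _
          ⟨{y}, measurableSet_singleton y, rfl⟩
      · exact biSup_mono (f := fun i => MeasurableSpace.comap (Y i) inferInstance)
          (fun i (hi : s + 1 ≤ i) => show s ≤ i by omega) _ (ih (l + y) (s + 1))
    · simp only [HitsZero, hl, false_and, or_false]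
      exact @MeasurableSet.const _ (_) (l = 0)

section RandomWalk

variable {Ω : Type*} [MeasurableSpace Ω] {μ : Measure Ω} {ν : ℤ → ℝ} {Y : ℕ → Ω → ℤ}

lemma measure_hitsZero [IsProbabilityMeasure μ] (hmeas : ∀ j, Measurable (Y j))
    (hindep : iIndepFun Y μ) (hlaw : ∀ j k, μ (Y j ⁻¹' {k}) = ENNReal.ofReal (ν k))
    (n : ℕ) (l : ℤ) (s : ℕ) :
    μ {ω | HitsZero n l fun m => Y (s + m) ω} = hitProb ν n l := by
  have hle : ∀ i, MeasurableSpace.comap (Y i) inferInstance ≤ ‹MeasurableSpace Ω› :=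
    fun i => (hmeas i).comap_le
  induction n generalizing l s with
  | zero => by_cases hl : l = 0 <;> simp [HitsZero, hitProb, hl]
  | succ n ih =>
    rcases lt_trichotomy l 0 with hl | rfl | hl
    · simp [HitsZero, hitProb, hl.ne, hl.not_gt]
    · simp [HitsZero, hitProb]
    have hA : ∀ y, MeasurableSet {ω | HitsZero n (l + y) fun m => Y (s + 1 + m) ω} :=
      fun y => iSup₂_le (fun i _ => hle i) _ (measurableSet_hitsZero Y n (l + y) (s + 1))
    rw [hitsZero_succ_eq_iUnion Y n s hl, hitProb_of_pos ν n hl, measure_iUnion]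
    · refine tsum_congr fun y => ?_
      have hdisj : Disjoint ({s} : Set ℕ) (Set.Ici (s + 1)) := by simp
      have hind := indep_iSup_of_disjoint hle hindep.iIndep hdisj
      rw [(Indep_iff _ _ μ).mp hind _ _ ?_ (measurableSet_hitsZero Y n (l + y) (s + 1)), hlaw, ih]
      rw [iSup_singleton]
      exact ⟨{y}, measurableSet_singleton y, rfl⟩
    · intro y z hyz
      refine Set.disjoint_left.mpr fun ω hy hz => hyz ?_
      exact hy.1.symm.trans hz.1
    · exact fun y => (hmeas s (measurableSet_singleton y)).inter (hA y)

lemma measurableSet_ladderTime_eq {S : Ω → ℕ → ℤ} (hS : ∀ j, Measurable fun ω => S ω j)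
    (i n : ℕ) : MeasurableSet {ω | ladderTime (S ω) i = n} := by
  induction i generalizing n with
  | zero => simp only [ladderTime]; exact .const _
  | succ i ih =>
    simp only [ladderTime_succ_eq_iff, Set.ofPred_exists, Set.ofPred_and, Set.ofPred_forall]
    refine .iUnion fun t => (ih t).inter ?_
    refine .inter (.const _) (.inter (measurableSet_lt (hS t) (hS n)) ?_)
    exact .iInter fun j => .iInter fun _ => .iInter fun _ => measurableSet_le (hS j) (hS t)

/-- The event that the `i`-th ladder height exists and lies in `B`. -/
def ladderHeightMem (S : Ω → ℕ → ℤ) (i : ℕ) (B : Set ℤ) : Set Ω :=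
  {ω | ∃ tn : ℕ, ladderTime (S ω) i = tn ∧ S ω tn ∈ B}

lemma measurableSet_ladderHeightMem {S : Ω → ℕ → ℤ} (hS : ∀ j, Measurable fun ω => S ω j)
    (i : ℕ) (B : Set ℤ) : MeasurableSet (ladderHeightMem S i B) := by
  simp only [ladderHeightMem, Set.ofPred_exists]
  exact .iUnion fun t => (measurableSet_ladderTime_eq hS i t).inter (hS t .of_discrete)

lemma tsum_measure_ladderHeight_eq [IsProbabilityMeasure μ] (hmeas : ∀ j, Measurable (Y j))
    (hindep : iIndepFun Y μ) (hlaw : ∀ j k, μ (Y j ⁻¹' {k}) = ENNReal.ofReal (ν k))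
    {S : Ω → ℕ → ℤ} (hS : ∀ ω j, S ω j = -∑ m ∈ Finset.range j, Y m ω) (l : ℤ) :
    ∑' i, μ (ladderHeightMem S i {l}) = ⨆ n, hitProb ν n l := by
  have hSm : ∀ j, Measurable fun ω => S ω j := fun j => by
    simp only [hS]
    exact (Finset.measurable_sum _ fun m _ => hmeas m).neg
  rw [← measure_iUnion _ fun i => measurableSet_ladderHeightMem hSm i {l}]
  · have hE : ⋃ i, ladderHeightMem S i {l} = ⋃ n, {ω | HitsZero n l fun m => Y (0 + m) ω} := by
      ext ω
      simp only [ladderHeightMem, Set.mem_iUnion, Set.mem_ofPred_eq, hitsZero_iff, zero_add,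
        Set.mem_singleton_iff]
      rw [exists_comm]
      simp only [exists_and_right, exists_ladderTime_eq_iff]
      constructor
      · rintro ⟨t, hlt, ht⟩
        refine ⟨t, t, le_rfl, ?_, fun j hj => ?_⟩
        · rw [hS] at ht
          linarith
        · have h := hlt j hj
          rw [ht, hS] at h
          linarith
      · rintro ⟨n, t, -, ht, hlt⟩
        have ht' : S ω t = l := by rw [hS]; linarith
        refine ⟨t, fun j hj => ?_, ht'⟩
        rw [ht', hS]
        linarith [hlt j hj]
    rw [hE, Monotone.measure_iUnion]
    · exact iSup_congr fun n => measure_hitsZero hmeas hindep hlaw n l 0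
    · intro m n hmn ω hω
      rw [Set.mem_ofPred_eq, hitsZero_iff] at hω ⊢
      obtain ⟨t, ht, h⟩ := hω
      exact ⟨t, ht.trans hmn, h⟩
  · intro i k hik
    refine Set.disjoint_left.mpr ?_
    rintro ω ⟨t, ht, hSt⟩ ⟨n, hn, hSn⟩
    exact hik (ladderTime_index_unique (S ω) ht hn (hSt.trans hSn.symm))

lemma measure_ladderHeight_le {S : Ω → ℕ → ℤ} (hS : ∀ j, Measurable fun ω => S ω j)
    (hS0 : ∀ ω, S ω 0 = 0) (i k : ℕ) :
    μ (ladderHeightMem S i (Set.Iic (k : ℤ))) =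
      ∑ p ∈ Finset.range (k + 1), μ (ladderHeightMem S i {(p : ℤ)}) := by
  rw [← measure_biUnion_finset]
  · congr 1
    ext ω
    simp only [ladderHeightMem, Set.mem_iUnion, Set.mem_ofPred_eq, Set.mem_Iic, Finset.mem_range,
      Set.mem_singleton_iff]
    constructor
    · rintro ⟨t, ht, hk⟩
      have h0 : 0 ≤ S ω t := by
        rcases t.eq_zero_or_pos with rfl | htpos
        · exact (hS0 ω).ge
        · exact (hS0 ω).ge.trans (lt_of_lt_ladderTime (S ω) ht 0 htpos).le
      exact ⟨(S ω t).toNat, by omega, t, ht, by omega⟩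
    · rintro ⟨p, hp, t, ht, hSt⟩
      exact ⟨t, ht, by omega⟩
  · intro p _ q _ hpq
    refine Set.disjoint_left.mpr ?_
    rintro ω ⟨t, ht, hSt⟩ ⟨n, hn, hSn⟩
    obtain rfl : t = n := by exact_mod_cast ht.symm.trans hn
    exact hpq (by exact_mod_cast hSt.symm.trans hSn)
  · exact fun p _ => measurableSet_ladderHeightMem hS i _

end RandomWalk

/-- the ladder height distribution is given by `h_r^{(0)}`, and the renewal
function by `h_r^{(1)}`.  Here `S j = X_0 - X_j = -(Y_0 + ⋯ + Y_{j-1})`, the `i`-th ladder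
height being `H_i = S (T_i)` (equal to `∞` when `T_i = ∞`). -/
theorem stmt7 {Ω : Type*} [MeasurableSpace Ω] (μ : Measure Ω) [IsProbabilityMeasure μ]
    (r : ℝ) (hr : r ∈ Set.Ioc (-1 : ℝ) 1)
    (ν : ℤ → ℝ) (hprob : IsProbDist ν) (hν2 : 0 < ν (-2))
    (hharm : NuHarmonic ν (h0 r))
    (Y : ℕ → Ω → ℤ) (hmeas : ∀ j, Measurable (Y j))
    (hindep : iIndepFun (m := fun _ : ℕ => (inferInstance : MeasurableSpace ℤ)) Y μ)
    (hlaw : ∀ j k, μ (Y j ⁻¹' {k}) = ENNReal.ofReal (ν k))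
    (S : Ω → ℕ → ℤ) (hS : ∀ ω j, S ω j = -∑ m ∈ Finset.range j, Y m ω) :
    (∀ l : ℕ,
      (∑' i : ℕ, μ {ω | ∃ tn : ℕ, ladderTime (S ω) i = (tn : ℕ∞) ∧ S ω tn = (l : ℤ)}) =
        ENNReal.ofReal (h0 r (l : ℤ))) ∧
    (∀ k : ℕ,
      (∑' i : ℕ, μ {ω | ∃ tn : ℕ, ladderTime (S ω) i = (tn : ℕ∞) ∧ S ω tn ≤ (k : ℤ)}) =
        ENNReal.ofReal (h1 r ((k : ℤ) + 1))) := by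
  have heq : ∀ l : ℤ, ∑' i, μ (ladderHeightMem S i {l}) = ENNReal.ofReal (h0 r l) := fun l => by
    rw [tsum_measure_ladderHeight_eq hmeas hindep hlaw hS,
      iSup_hitProb_eq_h0 hr hprob hν2 hharm]
  refine ⟨fun l => heq l, fun k => ?_⟩
  have hSm : ∀ j, Measurable fun ω => S ω j := fun j => by
    simp only [hS]
    exact (Finset.measurable_sum _ fun m _ => hmeas m).neg
  have hle := measure_ladderHeight_le (μ := μ) hSm (fun ω => by simp [hS])
  refine (tsum_congr fun i => hle i k).trans ?_
  rw [Summable.tsum_finsetSum fun _ _ => ENNReal.summable, h1, if_pos (by omega),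
    show ((k : ℤ) + 1).toNat = k + 1 by omega,
    ENNReal.ofReal_sum_of_nonneg fun (p : ℕ) _ => hharm.1 (p : ℤ)]
  exact Finset.sum_congr rfl fun p _ => heq p
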